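/- Let m be a universal probability and q ≥ 1 a real number. If ∑_{s∈{0,1}*} m(s)^q is a right-computable real number, then q is weakly Chaitin 1/q-random, i.e., there exists c ∈ ℕ with K(q_n) ≥ n/q - c for all n, where q_n is the first n bits of the binary expansion of q mod 1. -/

import Mathlib

open Filter Topology

namespace Paper

/-- Finite binary strings. -/
abbrev Str := List Bool

/-- A computer: a partial recursive function on binary strings with prefix-free domain. -/
structure Computer where
  f : Str →. Str
  partrec : Partrec f
  prefixFree : ∀ p q : Str, (f p).Dom → (f q).Dom → p <+: q → p = q

/-- An optimal computer (universal self-delimiting Turing machine). -/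
structure OptimalComputer extends Computer where
  optimal : ∀ C : Computer, ∃ sim : ℕ, ∀ p s, s ∈ C.f p →
    ∃ p', s ∈ toComputer.f p' ∧ p'.length ≤ p.length + sim

/-- Prefix-free Kolmogorov complexity (program-size complexity) w.r.t. `U`. -/
noncomputable def Kc (U : OptimalComputer) (s : Str) : ℕ :=
  sInf {n | ∃ p : Str, p.length = n ∧ s ∈ U.f p}

/-- A semi-measure on binary strings: values in [0,1] with all finite partial sums ≤ 1. -/
def SemiMeasure (r : Str → ℝ) : Prop :=
  (∀ s, 0 ≤ r s ∧ r s ≤ 1) ∧ ∀ F : Finset Str, ∑ s ∈ F, r s ≤ 1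

/-- Lower-computability: approximability from below by a total recursive rational function. -/
def LowerComputable (r : Str → ℝ) : Prop :=
  ∃ f : ℕ → Str → ℚ, Computable₂ f ∧
    ∀ s : Str, (∀ n : ℕ, 0 ≤ f n s ∧ (f n s : ℝ) ≤ r s) ∧
      Tendsto (fun n => (f n s : ℝ)) atTop (nhds (r s))

/-- A lower-computable semi-measure. -/
def LCSemiMeasure (r : Str → ℝ) : Prop := SemiMeasure r ∧ LowerComputable r

/-- A universal probability: a lower-computable semi-measure dominating all
lower-computable semi-measures up to a positive multiplicative constant. -/
def UniversalProb (m : Str → ℝ) : Prop :=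
  LCSemiMeasure m ∧ ∀ r : Str → ℝ, LCSemiMeasure r → ∃ c : ℝ, 0 < c ∧ ∀ s, c * r s ≤ m s

/-- The first `n` bits of the base-two expansion of `T mod 1`
(the expansion with infinitely many zeros). -/
noncomputable def binPrefix (T : ℝ) (n : ℕ) : Str :=
  (List.range n).map (fun i => decide (⌊Int.fract T * 2 ^ (i + 1)⌋ % 2 = 1))

/-- A real is right-computable if it is the limit from above of a recursive
sequence of rationals. -/
def RightComputableReal (T : ℝ) : Prop :=
  ∃ g : ℕ → ℚ, Computable g ∧ (∀ n, T ≤ (g n : ℝ)) ∧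
    Tendsto (fun n => (g n : ℝ)) atTop (nhds T)

/-- A real is left-computable if its negation is right-computable. -/
def LeftComputableReal (T : ℝ) : Prop := RightComputableReal (-T)

/-- A computable real number. -/
def ComputableReal (T : ℝ) : Prop :=
  ∃ f : ℕ → ℚ, Computable f ∧ ∀ n : ℕ, |T - (f n : ℝ)| < (2 : ℝ)⁻¹ ^ n

/-- A recursively enumerable set of binary strings. -/
def REset (A : Set Str) : Prop :=
  ∃ g : Str →. Unit, Partrec g ∧ ∀ s, (g s).Dom ↔ s ∈ A

/-- `T` is weakly Chaitin `D`-random. -/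
noncomputable def WeaklyChaitinDRandom (U : OptimalComputer) (D T : ℝ) : Prop :=
  ∃ c : ℕ, ∀ n : ℕ, D * n - c ≤ Kc U (binPrefix T n)

/-- `T` is `D`-compressible. -/
noncomputable def DCompressible (U : OptimalComputer) (D T : ℝ) : Prop :=
  Filter.atTop.limsup (fun n : ℕ => (Kc U (binPrefix T n) : ℝ) / n) ≤ D


open Encodable

theorem enc_rat (x : ℚ) : @encode ℚ (Primcodable.toEncodable) x =
   (List.range (@encode ℚ Rat.instEncodable x)).countP (fun k => @decide (k ∈ Set.range (@encode ℚ Rat.instEncodable)) (@decidableRangeEncode ℚ _ k)) := by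
  rfl
theorem enc_rat' (x : ℚ) :  (@encode ℚ Rat.instEncodable x) = Nat.pair (encode x.num) x.den := by
  rfl

theorem primrec_gcd : Primrec₂ Nat.gcd := by
  have h : Primrec₂ (fun a b : ℕ => Nat.findGreatest (fun d => a % d = 0 ∧ b % d = 0) (a + b)) := by
    have h1 : PrimrecRel (fun (p : ℕ × ℕ) (d : ℕ) => p.1 % d = 0 ∧ p.2 % d = 0) := by
      refine PrimrecPred.primrecRel (p := fun x : (ℕ × ℕ) × ℕ => x.1.1 % x.2 = 0 ∧ x.1.2 % x.2 = 0) ?_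
      refine PrimrecPred.and ?_ ?_
      · exact Primrec.eq.comp (Primrec.nat_mod.comp (Primrec.fst.comp Primrec.fst) Primrec.snd) (Primrec.const 0)
      · exact Primrec.eq.comp (Primrec.nat_mod.comp (Primrec.snd.comp Primrec.fst) Primrec.snd) (Primrec.const 0)
    exact Primrec.nat_findGreatest Primrec.nat_add h1
  refine h.of_eq fun a b => ?_
  rw [Nat.findGreatest_eq_iff]
  refine ⟨?_, ?_, ?_⟩
  · rcases Nat.eq_zero_or_pos a with h | h
    · simp [h]
    · exact (Nat.gcd_le_left _ h).trans (by omega)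
  · intro _
    exact ⟨Nat.mod_eq_zero_of_dvd (Nat.gcd_dvd_left a b), Nat.mod_eq_zero_of_dvd (Nat.gcd_dvd_right a b)⟩
  · rintro n hn hn' ⟨h1, h2⟩
    have := Nat.le_of_dvd (Nat.pos_of_ne_zero (by rintro h; rw [Nat.gcd_eq_zero_iff] at h; omega)) (Nat.dvd_gcd (Nat.dvd_of_mod_eq_zero h1) (Nat.dvd_of_mod_eq_zero h2))
    omega

theorem primrec_pow : Primrec₂ ((· ^ ·) : ℕ → ℕ → ℕ) :=
  Primrec₂.unpaired'.1 Nat.Primrec.pow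

theorem int_enc_nat (n : ℕ) : encode (n : ℤ) = 2 * n := rfl

theorem int_enc_neg (n : ℕ) : encode (Int.negSucc n) = 2 * n + 1 := rfl

theorem int_natAbs_enc (z : ℤ) : z.natAbs = (encode z + 1) / 2 := by
  cases z with
  | ofNat n =>
    have := int_enc_nat n
    simp only [Int.ofNat_eq_natCast, this, Int.natAbs_natCast]; omega
  | negSucc n => rw [int_enc_neg, Int.natAbs_negSucc]; omega

theorem int_enc_ofNat (k : ℕ) : encode (Denumerable.ofNat ℤ k) = k := Denumerable.encode_ofNat k

theorem mem_range_enc (k : ℕ) : k ∈ Set.range (@encode ℚ Rat.instEncodable) ↔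
    (0 < k.unpair.2 ∧ Nat.gcd ((k.unpair.1 + 1) / 2) k.unpair.2 = 1) := by
  constructor
  · rintro ⟨x, rfl⟩
    rw [enc_rat']
    simp only [Nat.unpair_pair, ← int_natAbs_enc]
    exact ⟨x.den_pos, x.reduced⟩
  · rintro ⟨h1, h2⟩
    refine ⟨⟨Denumerable.ofNat ℤ k.unpair.1, k.unpair.2, by omega, ?_⟩, ?_⟩
    · rw [int_natAbs_enc, int_enc_ofNat]; exact h2
    · rw [enc_rat']; show Nat.pair (encode (Denumerable.ofNat ℤ k.unpair.1)) k.unpair.2 = k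
      rw [int_enc_ofNat, Nat.pair_unpair]

theorem primrec_mk : Primrec₂ (fun a b : ℕ => (a : ℚ) / (b : ℚ)) := by
  refine Primrec₂.encode_iff.1 ?_
  have hP : PrimrecPred (fun k : ℕ => (0 < k.unpair.2 ∧ Nat.gcd ((k.unpair.1 + 1) / 2) k.unpair.2 = 1)) := by
    refine PrimrecPred.and ?_ ?_
    · exact Primrec.nat_lt.comp (Primrec.const 0) (Primrec.snd.comp Primrec.unpair)
    · exact Primrec.eq.comp (primrec_gcd.comp (Primrec.nat_div.comp (Primrec.succ.comp (Primrec.fst.comp Primrec.unpair)) (Primrec.const 2)) (Primrec.snd.comp Primrec.unpair)) (Primrec.const 1)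
  have hC : Primrec (fun n : ℕ => ((List.range n).filter (fun k : ℕ => decide (0 < k.unpair.2 ∧ Nat.gcd ((k.unpair.1 + 1) / 2) k.unpair.2 = 1))).length) :=
    Primrec.list_length.comp ((Primrec.listFilter hP).comp Primrec.list_range)
  have hE : Primrec₂ (fun a b : ℕ => if b = 0 then Nat.pair 0 1 else Nat.pair (2 * (a / Nat.gcd a b)) (b / Nat.gcd a b)) := by
    refine Primrec.ite ?_ (Primrec.const _) ?_
    · exact Primrec.eq.comp Primrec.snd (Primrec.const 0)
    · refine Primrec₂.natPair.comp ?_ ?_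
      · exact Primrec.nat_mul.comp (Primrec.const 2) (Primrec.nat_div.comp Primrec.fst (primrec_gcd.comp Primrec.fst Primrec.snd))
      · exact (Primrec.nat_div.comp Primrec.snd (primrec_gcd.comp Primrec.fst Primrec.snd))
  refine (hC.comp₂ hE).of_eq fun a b => ?_
  rw [enc_rat, List.countP_eq_length_filter]
  congr 1
  have : (@encode ℚ Rat.instEncodable ((a : ℚ) / (b : ℚ))) = if b = 0 then Nat.pair 0 1 else Nat.pair (2 * (a / Nat.gcd a b)) (b / Nat.gcd a b) := by
    rw [enc_rat']
    split_ifs with h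
    · subst h; simp; rfl
    · have h1 : ((a:ℚ)/(b:ℚ)).num = ((a / Nat.gcd a b : ℕ) : ℤ) := by
        have := Rat.num_div_eq_of_coprime (a := ((a / Nat.gcd a b : ℕ) : ℤ)) (b := ((b / Nat.gcd a b : ℕ) : ℤ)) ?_ ?_
        · rw [← this]
          congr 1
          have hg : (Nat.gcd a b : ℚ) ≠ 0 := by
            exact_mod_cast Nat.gcd_ne_zero_right h
          rw [Int.cast_natCast, Int.cast_natCast, Nat.cast_div (Nat.gcd_dvd_left a b) hg, Nat.cast_div (Nat.gcd_dvd_right a b) hg]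
          field_simp
        · exact_mod_cast Nat.div_gcd_pos_of_pos_right _ (by omega)
        · simpa using! Nat.coprime_div_gcd_div_gcd (Nat.gcd_pos_of_pos_right a (by omega))
      have h2 : ((a:ℚ)/(b:ℚ)).den = b / Nat.gcd a b := by
        have := Rat.den_div_eq_of_coprime (a := ((a / Nat.gcd a b : ℕ) : ℤ)) (b := ((b / Nat.gcd a b : ℕ) : ℤ)) ?_ ?_
        · zify; rw [← Int.natCast_div, ← this]
          congr 2
          have hg : (Nat.gcd a b : ℚ) ≠ 0 := by
            exact_mod_cast Nat.gcd_ne_zero_right h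
          rw [Int.cast_natCast, Int.cast_natCast, Nat.cast_div (Nat.gcd_dvd_left a b) hg, Nat.cast_div (Nat.gcd_dvd_right a b) hg]
          field_simp
        · exact_mod_cast Nat.div_gcd_pos_of_pos_right _ (by omega)
        · simpa using! Nat.coprime_div_gcd_div_gcd (Nat.gcd_pos_of_pos_right a (by omega))
      rw [h1, h2, int_enc_nat]
  rw [this]
  refine List.filter_congr fun k _ => ?_
  rw [Bool.eq_iff_iff, decide_eq_true_iff, @decide_eq_true_iff _ (_)]
  exact (mem_range_enc k).symm

theorem exists_num_den {α : Type*} [Primcodable α] {h : α → ℚ} (hh : Computable h) (h0 : ∀ a, 0 ≤ h a) :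
    ∃ N D : α → ℕ, Computable N ∧ Computable D ∧ ∀ a, 0 < D a ∧ h a = N a / D a := by
  have hex : ∀ a, ∃ n : ℕ, h a = (n.unpair.1 : ℚ) / ((n.unpair.2 + 1 : ℕ) : ℚ) := by
    intro a
    refine ⟨Nat.pair (h a).num.toNat ((h a).den - 1), ?_⟩
    have h1 : (h a).den - 1 + 1 = (h a).den := Nat.sub_add_cancel (h a).den_pos
    have h2 : (((h a).num.toNat : ℤ) : ℚ) = (h a).num := by
      rw [Int.toNat_of_nonneg (Rat.num_nonneg.2 (h0 a))]
    rw [Nat.unpair_pair, h1]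
    conv_lhs => rw [← Rat.num_div_den (h a), ← h2]
    rw [Int.cast_natCast]
  let F : α → ℕ := fun a => Nat.find (hex a)
  have hF : Computable F := by
    have hp : Computable₂ (fun (a : α) (n : ℕ) => decide (h a = (n.unpair.1 : ℚ) / ((n.unpair.2 + 1 : ℕ) : ℚ))) := by
      have := (Primrec.beq (α := ℚ)).to_comp.comp (hh.comp (Computable.fst (β := ℕ)))
        (primrec_mk.to_comp.comp (Computable.fst.comp (Computable.unpair.comp Computable.snd))
        (Computable.succ.comp (Computable.snd.comp (Computable.unpair.comp Computable.snd))))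
      exact this.of_eq fun _ => rfl
    have := Partrec.rfind (p := fun (a : α) (n : ℕ) => Part.some (decide (h a = (n.unpair.1 : ℚ) / ((n.unpair.2 + 1 : ℕ) : ℚ)))) hp.partrec₂
    refine this.of_eq_tot fun a => ?_
    refine Nat.mem_rfind.2 ⟨?_, ?_⟩
    · exact Part.mem_some_iff.2 (decide_eq_true (Nat.find_spec (hex a))).symm
    · intro m hm
      exact Part.mem_some_iff.2 (decide_eq_false (Nat.find_min (hex a) hm)).symm
  refine ⟨fun a => (F a).unpair.1, fun a => (F a).unpair.2 + 1, ?_, ?_, fun a => ⟨Nat.succ_pos _, Nat.find_spec (hex a)⟩⟩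
  · exact Computable.fst.comp (Computable.unpair.comp hF)
  · exact Computable.succ.comp (Computable.snd.comp (Computable.unpair.comp hF))

theorem computable_sum {α : Type*} [Primcodable α] {k : α → ℕ} {F : α → ℕ → ℕ} (hk : Computable k) (hF : Computable₂ F) :
    Computable (fun a => ∑ i ∈ Finset.range (k a), F a i) := by
  have := Computable.nat_rec (f := k) (g := fun _ : α => 0) (h := fun a (p : ℕ × ℕ) => p.2 + F a p.1) hk (Computable.const 0)
    (Primrec.nat_add.to_comp.comp (Computable.snd.comp Computable.snd) (hF.comp Computable.fst (Computable.fst.comp Computable.snd)))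
  refine this.of_eq fun a => ?_
  induction k a with
  | zero => rfl
  | succ n ih => rw [Finset.sum_range_succ, ← ih]

theorem kraft (S : Finset Str) (h : ∀ p ∈ S, ∀ q ∈ S, p <+: q → p = q) :
    ∑ p ∈ S, (2 : ℝ)⁻¹ ^ p.length ≤ 1 := by
  by_cases he : [] ∈ S
  · have : S = {[]} := by
      ext x
      simp only [Finset.mem_singleton]
      exact ⟨fun hx => (h [] he x hx List.nil_prefix).symm, fun hx => hx ▸ he⟩
    simp [this]
  · have hu : InformationTheory.UniquelyDecodable (S : Set Str) := by
      intro L₁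
      induction L₁ with
      | nil =>
        intro L₂ _ h2 h3
        cases L₂ with
        | nil => rfl
        | cons a L =>
          exfalso
          have : a = [] := by
            simp only [List.flatten_nil, List.flatten_cons] at h3
            exact (List.append_eq_nil_iff.1 h3.symm).1
          exact he (this ▸ h2 a (by simp))
      | cons b L₁ ih =>
        intro L₂ h1 h2 h3
        cases L₂ with
        | nil =>
          exfalso
          have : b = [] := by
            simp only [List.flatten_nil, List.flatten_cons] at h3
            exact (List.append_eq_nil_iff.1 h3).1
          exact he (this ▸ h1 b (by simp))
        | cons a L =>
          have hb : b ∈ S := h1 b (by simp)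
          have ha : a ∈ S := h2 a (by simp)
          simp only [List.flatten_cons] at h3
          have hab : a = b := by
            have p1 : b <+: a ++ L.flatten := ⟨_, h3⟩
            have p2 : a <+: a ++ L.flatten := ⟨_, rfl⟩
            rcases List.prefix_or_prefix_of_prefix p1 p2 with h' | h'
            · exact (h _ hb _ ha h').symm
            · exact h _ ha _ hb h'
          subst hab
          rw [ih L (fun w hw => h1 w (by simp [hw])) (fun w hw => h2 w (by simp [hw])) (List.append_cancel_left h3)]
    have := InformationTheory.kraft_mcmillan_inequality hu
    simpa using this

open Nat.Partrec (Code)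
open Nat.Partrec.Code

/-- Decoding of naturals into strings. -/
def dec (i : ℕ) : Str := (decode (α := Str) i).getD []

/-- Codes of strings. -/
def valid (i : ℕ) : Prop := encode (dec i) = i

instance : DecidablePred valid := fun i => inferInstanceAs (Decidable (encode (dec i) = i))

theorem dec_encode (s : Str) : dec (encode s) = s := by simp [dec]

theorem valid_encode (s : Str) : valid (encode s) := by unfold valid; rw [dec_encode]

theorem primrec_dec : Primrec dec :=
  Primrec.option_getD.comp Primrec.decode (Primrec.const [])

theorem primrec_valid : PrimrecPred valid :=
  Primrec.eq.comp (Primrec.encode.comp primrec_dec) Primrec.id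

theorem valid_decode {i : ℕ} (h : valid i) : decode (α := Str) i = some (dec i) := by
  conv_lhs => rw [← h]
  simp

/-- The finite set of strings with code below `k`. -/
def Sk (k : ℕ) : Finset Str := ((Finset.range k).filter valid).image dec

theorem mem_Sk (k : ℕ) (s : Str) : s ∈ Sk k ↔ encode s < k := by
  simp only [Sk, Finset.mem_image, Finset.mem_filter, Finset.mem_range]
  constructor
  · rintro ⟨i, ⟨h1, h2⟩, rfl⟩
    rw [h2]; exact h1
  · intro h
    exact ⟨encode s, ⟨h, valid_encode s⟩, dec_encode s⟩

theorem sum_Sk {β : Type*} [AddCommMonoid β] (k : ℕ) (φ : Str → β) :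
    ∑ i ∈ Finset.range k, (if valid i then φ (dec i) else 0) = ∑ s ∈ Sk k, φ s := by
  rw [← Finset.sum_filter, Sk, Finset.sum_image]
  intro i hi j hj hij
  simp only [Finset.coe_filter, Set.mem_ofPred_eq] at hi hj
  rw [← hi.2, ← hj.2, hij]

theorem Sk_tendsto : Tendsto Sk atTop atTop := by
  refine tendsto_atTop_finset_of_monotone ?_ fun s => ⟨encode s + 1, ?_⟩
  · intro a b hab s hs
    rw [mem_Sk] at *
    omega
  · rw [mem_Sk]; omega

/-- Stage-`n` approximation of the algorithmic probability of `s`. -/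
noncomputable def rhoN (c : Code) (n : ℕ) (s : Str) : ℝ :=
  ∑ i ∈ Finset.range n, if valid i ∧ evaln n c i = some (encode s) then (2 : ℝ)⁻¹ ^ (dec i).length else 0

theorem rhoN_nonneg (c : Code) (n : ℕ) (s : Str) : 0 ≤ rhoN c n s := by
  unfold rhoN
  refine Finset.sum_nonneg fun i _ => ?_
  split_ifs <;> positivity

theorem rhoN_mono (c : Code) (s : Str) : Monotone (fun n => rhoN c n s) := by
  intro a b hab
  simp only [rhoN]
  refine (Finset.sum_le_sum (g := fun i => if valid i ∧ evaln b c i = some (encode s) then (2 : ℝ)⁻¹ ^ (dec i).length else 0) fun i _ => ?_).trans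
    (Finset.sum_le_sum_of_subset_of_nonneg (Finset.range_subset_range.2 hab) fun i _ _ => ?_)
  · by_cases h : evaln a c i = some (encode s)
    · have : evaln b c i = some (encode s) := evaln_mono hab h
      simp [h, this]
    · simp only [h, and_false, if_false]; split_ifs <;> positivity
  · split_ifs <;> positivity

theorem rhoN_sum_le (C : Computer) (c : Code)
    (hc : eval c = fun n => Part.bind (decode (α := Str) n) fun a => (C.f a).map encode) (n : ℕ) (F : Finset Str) :
    ∑ s ∈ F, rhoN c n s ≤ 1 := by
  classical
  unfold rhoN
  rw [Finset.sum_comm]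
  have h1 : ∀ i ∈ Finset.range n, ∑ s ∈ F, (if valid i ∧ evaln n c i = some (encode s) then (2 : ℝ)⁻¹ ^ (dec i).length else 0)
     ≤ if valid i ∧ (C.f (dec i)).Dom then (2 : ℝ)⁻¹ ^ (dec i).length else 0 := by
    intro i _
    by_cases hs : ∃ s ∈ F, valid i ∧ evaln n c i = some (encode s)
    · obtain ⟨s, hsF, hv, hs⟩ := hs
      have hd : (C.f (dec i)).Dom := by
        have := evaln_sound (Option.mem_def.2 hs)
        rw [hc] at this
        simp only [valid_decode hv, Part.coe_some, Part.bind_some, Part.mem_map_iff] at this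
        obtain ⟨a, ha, _⟩ := this
        exact Part.dom_iff_mem.2 ⟨a, ha⟩
      rw [if_pos ⟨hv, hd⟩, Finset.sum_eq_single s]
      · rw [if_pos ⟨hv, hs⟩]
      · intro b _ hb
        rw [if_neg]
        rw [hs]
        rintro ⟨_, h⟩
        exact hb (encode_injective (Option.some.inj h)).symm
      · intro h; exact absurd hsF h
    · rw [Finset.sum_eq_zero]
      · split_ifs <;> positivity
      · intro s hsF
        rw [if_neg (fun h => hs ⟨s, hsF, h⟩)]
  refine (Finset.sum_le_sum h1).trans ?_
  simp only [ite_and]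
  rw [sum_Sk n (fun p => if (C.f p).Dom then (2 : ℝ)⁻¹ ^ p.length else 0), ← Finset.sum_filter]
  refine kraft _ ?_
  simp only [Finset.mem_filter]
  rintro p ⟨_, hi⟩ q ⟨_, hj⟩ hp
  exact C.prefixFree _ _ hi hj hp

theorem rhoN_computable (c : Code) : ∃ f : ℕ → Str → ℚ, Computable₂ f ∧ ∀ n s, (f n s : ℝ) = rhoN c n s := by
  have h1 : Computable (fun x : ℕ × Str => ∑ i ∈ Finset.range x.1,
      if valid i ∧ evaln x.1 c i = some (encode x.2) then 2 ^ (x.1 - (dec i).length) else 0) := by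
    refine computable_sum Computable.fst (Primrec.to_comp ?_)
    have e1 : Primrec (fun x : (ℕ × Str) × ℕ => evaln x.1.1 c x.2) :=
      primrec_evaln.comp (((Primrec.fst.comp Primrec.fst).pair (Primrec.const c)).pair Primrec.snd)
    refine Primrec.ite ?_ ?_ (Primrec.const 0)
    · refine PrimrecPred.and (primrec_valid.comp Primrec.snd) ?_
      exact Primrec.eq.comp e1 (Primrec.option_some.comp (Primrec.encode.comp (Primrec.snd.comp Primrec.fst)))
    · exact primrec_pow.comp (Primrec.const 2) (Primrec.nat_sub.comp (Primrec.fst.comp Primrec.fst) (Primrec.list_length.comp (primrec_dec.comp Primrec.snd)))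
  refine ⟨fun n s => ((∑ i ∈ Finset.range n,
      if valid i ∧ evaln n c i = some (encode s) then 2 ^ (n - (dec i).length) else 0 : ℕ) : ℚ) / ((2 ^ n : ℕ) : ℚ), ?_, ?_⟩
  · exact primrec_mk.to_comp.comp h1 (primrec_pow.comp (Primrec.const 2) Primrec.fst).to_comp
  · intro n s
    unfold rhoN
    push_cast
    rw [Finset.sum_div]
    refine Finset.sum_congr rfl fun i hi => ?_
    split_ifs with hcond
    · have hl : (dec i).length ≤ n := by
        have := length_le_encode (dec i)
        rw [hcond.1] at this
        exact this.trans (Finset.mem_range.1 hi).le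
      rw [pow_sub₀ _ (by norm_num) hl]
      push_cast
      rw [inv_pow]
      field_simp
    · simp

/-- Universal probabilities dominate the output probabilities of any computer. -/
theorem univ_dom (m : Str → ℝ) (hm : UniversalProb m) (C : Computer) :
    ∃ c : ℝ, 0 < c ∧ ∀ p s, s ∈ C.f p → c * (2 : ℝ)⁻¹ ^ p.length ≤ m s := by
  obtain ⟨c, hc⟩ := exists_code.1 C.partrec
  have bdd : ∀ s n, rhoN c n s ≤ 1 := fun s n => by
    simpa using rhoN_sum_le C c hc n {s}
  have hbdd : ∀ s, BddAbove (Set.range fun n => rhoN c n s) := fun s => ⟨1, by rintro _ ⟨n, rfl⟩; exact bdd s n⟩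
  have ht : ∀ s, Tendsto (fun n => rhoN c n s) atTop (nhds (⨆ n, rhoN c n s)) := fun s =>
    tendsto_atTop_ciSup (rhoN_mono c s) (hbdd s)
  obtain ⟨f, hf, hf'⟩ := rhoN_computable c
  have hle : ∀ s n, rhoN c n s ≤ ⨆ n, rhoN c n s := fun s n => le_ciSup (hbdd s) n
  have hr : LCSemiMeasure (fun s => ⨆ n, rhoN c n s) := by
    refine ⟨⟨fun s => ⟨(rhoN_nonneg c 0 s).trans (hle s 0), ciSup_le (bdd s)⟩, fun F => ?_⟩, f, hf, fun s => ⟨fun n => ⟨?_, ?_⟩, ?_⟩⟩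
    · exact le_of_tendsto' (tendsto_finsetSum F fun s _ => ht s) fun n => rhoN_sum_le C c hc n F
    · have := rhoN_nonneg c n s
      rw [← hf'] at this
      exact_mod_cast this
    · rw [hf']; exact hle s n
    · simp only [hf']; exact ht s
  obtain ⟨d, hd, hd'⟩ := hm.2 _ hr
  refine ⟨d, hd, fun p s hs => le_trans ?_ (hd' s)⟩
  refine mul_le_mul_of_nonneg_left ?_ hd.le
  have : encode s ∈ eval c (encode p) := by
    rw [hc]
    simp only [encodek, Part.coe_some, Part.bind_some, Part.mem_map_iff]
    exact ⟨s, hs, rfl⟩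
  obtain ⟨k, hk⟩ := evaln_complete.1 this
  refine le_trans ?_ (hle s k)
  unfold rhoN
  have hkk := evaln_bound hk
  refine le_trans ?_ (Finset.single_le_sum (f := fun i => if valid i ∧ evaln k c i = some (encode s) then (2 : ℝ)⁻¹ ^ (dec i).length else 0) (fun i _ => ?_) (Finset.mem_range.2 hkk))
  · simp only [dec_encode]
    rw [if_pos (And.intro (valid_encode p) <| Option.mem_def.1 hk)]
  · show 0 ≤ ite _ _ _
    split_ifs <;> positivity

/-- Integer part of `2 ^ k * (A / D) ^ (a / b)`, for `A ≤ D`. -/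
def rt (k a b A D : ℕ) : ℕ := Nat.findGreatest (fun N => N ^ b * D ^ a ≤ 2 ^ (k * b) * A ^ a) (2 ^ k)

theorem primrec_rt : Primrec (fun x : ℕ × ℕ × ℕ × ℕ × ℕ => rt x.1 x.2.1 x.2.2.1 x.2.2.2.1 x.2.2.2.2) := by
  unfold rt
  refine Primrec.nat_findGreatest (primrec_pow.comp (Primrec.const 2) Primrec.fst) ?_
  refine PrimrecPred.primrecRel (p := fun y : (ℕ × ℕ × ℕ × ℕ × ℕ) × ℕ =>
    y.2 ^ y.1.2.2.1 * y.1.2.2.2.2 ^ y.1.2.1 ≤ 2 ^ (y.1.1 * y.1.2.2.1) * y.1.2.2.2.1 ^ y.1.2.1) ?_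
  have hk : Primrec (fun y : (ℕ × ℕ × ℕ × ℕ × ℕ) × ℕ => y.1.1) := Primrec.fst.comp Primrec.fst
  have h1 : Primrec (fun y : (ℕ × ℕ × ℕ × ℕ × ℕ) × ℕ => y.1.2) := Primrec.snd.comp Primrec.fst
  have ha : Primrec (fun y : (ℕ × ℕ × ℕ × ℕ × ℕ) × ℕ => y.1.2.1) := Primrec.fst.comp h1
  have h2 : Primrec (fun y : (ℕ × ℕ × ℕ × ℕ × ℕ) × ℕ => y.1.2.2) := Primrec.snd.comp h1
  have hb : Primrec (fun y : (ℕ × ℕ × ℕ × ℕ × ℕ) × ℕ => y.1.2.2.1) := Primrec.fst.comp h2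
  have h3 : Primrec (fun y : (ℕ × ℕ × ℕ × ℕ × ℕ) × ℕ => y.1.2.2.2) := Primrec.snd.comp h2
  have hA : Primrec (fun y : (ℕ × ℕ × ℕ × ℕ × ℕ) × ℕ => y.1.2.2.2.1) := Primrec.fst.comp h3
  have hD : Primrec (fun y : (ℕ × ℕ × ℕ × ℕ × ℕ) × ℕ => y.1.2.2.2.2) := Primrec.snd.comp h3
  exact Primrec.nat_le.comp
    (Primrec.nat_mul.comp (primrec_pow.comp Primrec.snd hb) (primrec_pow.comp hD ha))
    (Primrec.nat_mul.comp (primrec_pow.comp (Primrec.const 2) (Primrec.nat_mul.comp hk hb)) (primrec_pow.comp hA ha))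

theorem computable_rt {α : Type*} [Primcodable α] {k a b A D : α → ℕ} (hk : Computable k) (ha : Computable a)
    (hb : Computable b) (hA : Computable A) (hD : Computable D) :
    Computable (fun y => rt (k y) (a y) (b y) (A y) (D y)) :=
  primrec_rt.to_comp.comp (hk.pair (ha.pair (hb.pair (hA.pair hD))))

theorem rt_iff (k a b A D N : ℕ) (hb : 0 < b) (hD : 0 < D) :
    N ^ b * D ^ a ≤ 2 ^ (k * b) * A ^ a ↔ (N : ℝ) / 2 ^ k ≤ ((A : ℝ) / D) ^ ((a : ℝ) / b) := by
  have hDr : (0 : ℝ) < D := by exact_mod_cast hD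
  have hx : (0 : ℝ) ≤ (A : ℝ) / D := by positivity
  have hy : (((A : ℝ) / D) ^ ((a : ℝ) / b)) ^ b = (A : ℝ) ^ a / D ^ a := by
    rw [← Real.rpow_natCast, ← Real.rpow_mul hx, div_mul_cancel₀ _ (by positivity), Real.rpow_natCast, div_pow]
  rw [← pow_le_pow_iff_left₀ (a := (N : ℝ) / 2 ^ k) (by positivity) (by positivity) hb.ne', hy, div_pow, ← pow_mul,
    div_le_div_iff₀ (by positivity) (by positivity)]
  rw [← Nat.cast_le (α := ℝ)]
  push_cast
  rw [mul_comm ((2 : ℝ) ^ (k * b))]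

theorem rt_le (k a b A D : ℕ) (hb : 0 < b) (hD : 0 < D) :
    (rt k a b A D : ℝ) / 2 ^ k ≤ ((A : ℝ) / D) ^ ((a : ℝ) / b) := by
  rw [← rt_iff _ _ _ _ _ _ hb hD]
  refine Nat.findGreatest_spec (P := fun N => N ^ b * D ^ a ≤ 2 ^ (k * b) * A ^ a) (Nat.zero_le _) ?_
  rw [zero_pow hb.ne']; simp

theorem le_rt (k a b A D : ℕ) (hb : 0 < b) (hD : 0 < D) (hAD : A ≤ D) :
    ((A : ℝ) / D) ^ ((a : ℝ) / b) - (2 : ℝ)⁻¹ ^ k ≤ (rt k a b A D : ℝ) / 2 ^ k := by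
  have hDr : (0 : ℝ) < D := by exact_mod_cast hD
  have hle1 : ((A : ℝ) / D) ^ ((a : ℝ) / b) ≤ 1 := by
    refine Real.rpow_le_one (by positivity) ?_ (by positivity)
    rw [div_le_one hDr]; exact_mod_cast hAD
  have h2 : (0 : ℝ) < (2 : ℝ)⁻¹ ^ k := by positivity
  rcases (Nat.findGreatest_le (P := fun N => N ^ b * D ^ a ≤ 2 ^ (k * b) * A ^ a) (2 ^ k)).lt_or_eq with h | h
  · have := Nat.findGreatest_is_greatest (P := fun N => N ^ b * D ^ a ≤ 2 ^ (k * b) * A ^ a) (Nat.lt_succ_self _) h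
    rw [rt_iff _ _ _ _ _ _ hb hD, not_le] at this
    rw [sub_le_iff_le_add]
    refine this.le.trans (le_of_eq ?_)
    unfold rt
    push_cast
    rw [add_div, one_div, inv_pow]
  · unfold rt
    rw [h]
    push_cast
    rw [div_self (by positivity)]
    linarith

/-- Value of a bit string as a binary number. -/
def bval (t : Str) : ℕ := t.foldl (fun a b => 2 * a + b.toNat) 0

theorem primrec_bval : Primrec bval := by
  refine Primrec.list_foldl (α := Str) (β := Bool) (σ := ℕ) (f := fun t => t) (g := fun _ => 0)
    (h := fun _ p => 2 * p.1 + p.2.toNat) Primrec.id (Primrec.const 0) ?_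
  exact (Primrec.nat_add.comp (Primrec.nat_mul.comp (Primrec.const 2) (Primrec.fst.comp Primrec.snd))
    ((Primrec.dom_bool Bool.toNat).comp (Primrec.snd.comp Primrec.snd)))

theorem primrec_replicate : Primrec (fun k : ℕ => List.replicate k true) :=
  (Primrec.list_map Primrec.list_range (Primrec.const true).to₂).of_eq fun k => by simp

theorem main_search (m : Str → ℝ) (hm : LCSemiMeasure m) (q : ℝ) (hq : 1 ≤ q)
    (hrc : RightComputableReal (∑' s, m s ^ q)) (Q : ℕ) :
    ∃ h : Str →. Str, Partrec h ∧ ∀ t : Str, ∀ r : ℝ, r = Q + (bval t : ℝ) / 2 ^ t.length → 1 ≤ r → r ≤ q →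
      (h t).Dom ∧ ∀ s ∈ h t, ∀ B : ℝ, 0 ≤ B → (∀ x : ℝ, 0 ≤ x → x ≤ 1 → x ^ r - x ^ q ≤ B * x) →
        m s ^ q ≤ (2 : ℝ)⁻¹ ^ t.length + B := by
  obtain ⟨⟨hm01, hmsum⟩, f, hf, hfm⟩ := hm
  obtain ⟨g, hg, hgS, hgt⟩ := hrc
  have hms : Summable m := summable_of_sum_le (fun s => (hm01 s).1) hmsum
  have hmq0 : ∀ s, 0 ≤ m s ^ q := fun s => Real.rpow_nonneg (hm01 s).1 q
  have hmqs : Summable (fun s => m s ^ q) := by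
    refine Summable.of_nonneg_of_le hmq0 (fun s => ?_) hms
    exact Real.rpow_le_self_of_le_one (hm01 s).1 (hm01 s).2 hq
  set S := ∑' s, m s ^ q with hS
  have hS0 : 0 ≤ S := tsum_nonneg hmq0
  obtain ⟨Nf, Df, hNf, hDf, hfe⟩ := exists_num_den (h := fun x : ℕ × Str => f x.1 x.2) hf (fun x => ((hfm x.2).1 x.1).1)
  obtain ⟨Ng, Dg, hNg, hDg, hge⟩ := exists_num_den hg (fun k => by
    have := hS0.trans (hgS k); exact_mod_cast this)
  have hfr : ∀ k s, (f k s : ℝ) = (Nf (k, s) : ℝ) / Df (k, s) := by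
    intro k s
    have := (hfe (k, s)).2
    simp only at this
    rw [this]; push_cast; rfl
  have hgr : ∀ k, (g k : ℝ) = (Ng k : ℝ) / Dg k := by
    intro k
    rw [(hge k).2]; push_cast; rfl
  have hf0 : ∀ k s, (0 : ℝ) ≤ f k s := fun k s => by exact_mod_cast ((hfm s).1 k).1
  have hfle : ∀ k s, (f k s : ℝ) ≤ m s := fun k s => ((hfm s).1 k).2
  have hND : ∀ k s, Nf (k, s) ≤ Df (k, s) := by
    intro k s
    have h1 := (hfle k s).trans (hm01 s).2
    rw [hfr, div_le_one (by exact_mod_cast (hfe (k, s)).1)] at h1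
    exact_mod_cast h1
  let R : Str → ℕ → Str → ℕ := fun t k s => rt k (Q * 2 ^ t.length + bval t) (2 ^ t.length) (Nf (k, s)) (Df (k, s))
  let T : Str → ℕ → ℕ := fun t k => ∑ i ∈ Finset.range k, if valid i then R t k (dec i) else 0
  have hT : Computable₂ T := by
    refine computable_sum (α := Str × ℕ) (k := fun x => x.2) (F := fun x i => if valid i then R x.1 x.2 (dec i) else 0) Computable.snd ?_
    have ht : Computable (fun y : (Str × ℕ) × ℕ => y.1.1) := Computable.fst.comp Computable.fst
    have hk : Computable (fun y : (Str × ℕ) × ℕ => y.1.2) := Computable.snd.comp Computable.fst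
    have hd : Computable (fun y : (Str × ℕ) × ℕ => (y.1.2, dec y.2)) := hk.pair (primrec_dec.to_comp.comp Computable.snd)
    have hb : Computable (fun y : (Str × ℕ) × ℕ => 2 ^ y.1.1.length) :=
      primrec_pow.to_comp.comp (Computable.const 2) (Computable.list_length.comp ht)
    have ha : Computable (fun y : (Str × ℕ) × ℕ => Q * 2 ^ y.1.1.length + bval y.1.1) :=
      Primrec.nat_add.to_comp.comp (Primrec.nat_mul.to_comp.comp (Computable.const Q) hb) (primrec_bval.to_comp.comp ht)
    have hR : Computable (fun y : (Str × ℕ) × ℕ => R y.1.1 y.1.2 (dec y.2)) :=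
      computable_rt hk ha hb (hNf.comp hd) (hDf.comp hd)
    have hcond := Computable.cond (primrec_valid.decide.to_comp.comp Computable.snd) hR (Computable.const 0)
    refine hcond.of_eq fun y => ?_
    show (bif decide (valid y.2) then R y.1.1 y.1.2 (dec y.2) else 0) = if valid y.2 then R y.1.1 y.1.2 (dec y.2) else 0
    by_cases h : valid y.2
    · rw [if_pos h, decide_eq_true h]; rfl
    · rw [if_neg h, decide_eq_false h]; rfl
  let P : Str → ℕ → Bool := fun t k =>
    decide (2 ^ k * Ng k * 2 ^ t.length < T t k * Dg k * 2 ^ t.length + 2 ^ k * Dg k)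
  have hP : Computable₂ P := by
    have hk : Computable (fun y : Str × ℕ => 2 ^ y.2) := primrec_pow.to_comp.comp (Computable.const 2) Computable.snd
    have hn : Computable (fun y : Str × ℕ => 2 ^ y.1.length) := primrec_pow.to_comp.comp (Computable.const 2) (Computable.list_length.comp Computable.fst)
    have hD : Computable (fun y : Str × ℕ => Dg y.2) := hDg.comp Computable.snd
    have hN : Computable (fun y : Str × ℕ => Ng y.2) := hNg.comp Computable.snd
    have mul {u v : Str × ℕ → ℕ} (hu : Computable u) (hv : Computable v) : Computable (fun y => u y * v y) := Primrec.nat_mul.to_comp.comp hu hv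
    have hT' : Computable (fun y : Str × ℕ => T y.1 y.2) := hT
    have hsum : Computable (fun y : Str × ℕ => T y.1 y.2 * Dg y.2 * 2 ^ y.1.length + 2 ^ y.2 * Dg y.2) :=
      Primrec.nat_add.to_comp.comp (mul (mul hT' hD) hn) (mul hk hD)
    exact Primrec.nat_lt.decide.to_comp.comp (mul (mul hk hN) hn) hsum
  let h : Str →. Str := fun t => (Nat.rfind fun k => Part.some (P t k)).map fun k => List.replicate k true
  have hh : Partrec h :=
    (Partrec.rfind (p := fun (t : Str) (k : ℕ) => Part.some (P t k)) hP.partrec₂).map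
      (primrec_replicate.to_comp.comp Computable.snd)
  refine ⟨h, hh, fun t r hr hr1 hrq => ?_⟩
  have hPiff : ∀ k, P t k = true ↔ (g k : ℝ) < (T t k : ℝ) / 2 ^ k + (2 : ℝ)⁻¹ ^ t.length := by
    intro k
    have hDk : (0 : ℝ) < Dg k := by exact_mod_cast (hge k).1
    simp only [P, decide_eq_true_eq]
    rw [← Nat.cast_lt (α := ℝ), hgr]
    push_cast
    rw [inv_pow, ← one_div, div_add_div _ _ (by positivity) (by positivity), div_lt_div_iff₀ hDk (by positivity)]
    constructor <;> intro h <;> linarith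
  have hTr : ∀ k, (T t k : ℝ) / 2 ^ k = ∑ s ∈ Sk k, (R t k s : ℝ) / 2 ^ k := by
    intro k
    have : T t k = ∑ s ∈ Sk k, R t k s := sum_Sk k (R t k)
    rw [this, Nat.cast_sum, Finset.sum_div]
  have hre : (((Q * 2 ^ t.length + bval t : ℕ) : ℝ)) / ((2 ^ t.length : ℕ) : ℝ) = r := by
    rw [hr]; push_cast; field_simp
  have hRle : ∀ k s, (R t k s : ℝ) / 2 ^ k ≤ (f k s : ℝ) ^ r := by
    intro k s
    rw [hfr, ← hre]
    exact rt_le _ _ _ _ _ (by positivity) (hfe (k, s)).1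
  have hRge : ∀ k s, (f k s : ℝ) ^ r - (2 : ℝ)⁻¹ ^ k ≤ (R t k s : ℝ) / 2 ^ k := by
    intro k s
    rw [hfr, ← hre]
    exact le_rt _ _ _ _ _ (by positivity) (hfe (k, s)).1 (hND k s)
  constructor
  · -- termination
    have hn : (0 : ℝ) < (2 : ℝ)⁻¹ ^ t.length := by positivity
    have h1 : Tendsto (fun j => ∑ s ∈ Sk j, m s ^ q) atTop (nhds S) := hmqs.hasSum.comp Sk_tendsto
    obtain ⟨j, hj⟩ := (h1.eventually (lt_mem_nhds (show S - (2 : ℝ)⁻¹ ^ t.length < S by linarith))).exists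
    have hj' : ∑ s ∈ Sk j, m s ^ q ≤ ∑ s ∈ Sk j, m s ^ r := by
      refine Finset.sum_le_sum fun s _ => ?_
      exact Real.rpow_le_rpow_of_exponent_ge' (hm01 s).1 (hm01 s).2 (by linarith) hrq
    have h2 : Tendsto (fun k => ∑ s ∈ Sk j, ((f k s : ℝ) ^ r - (2 : ℝ)⁻¹ ^ k) - g k) atTop
        (nhds (∑ s ∈ Sk j, (m s ^ r - 0) - S)) := by
      refine Tendsto.sub (tendsto_finsetSum _ fun s _ => Tendsto.sub ?_ ?_) hgt
      · exact (hfm s).2.rpow_const (Or.inr (by linarith))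
      · exact tendsto_pow_atTop_nhds_zero_of_lt_one (by norm_num) (by norm_num)
    simp only [sub_zero] at h2
    obtain ⟨k, hk, hjk⟩ := ((h2.eventually (lt_mem_nhds (show -(2 : ℝ)⁻¹ ^ t.length < _ by linarith))).and (eventually_ge_atTop j)).exists
    have hPk : P t k = true := by
      rw [hPiff, hTr]
      have e1 : ∑ s ∈ Sk j, ((f k s : ℝ) ^ r - (2 : ℝ)⁻¹ ^ k) ≤ ∑ s ∈ Sk j, (R t k s : ℝ) / 2 ^ k :=
        Finset.sum_le_sum fun s _ => hRge k s
      have e2 : ∑ s ∈ Sk j, (R t k s : ℝ) / 2 ^ k ≤ ∑ s ∈ Sk k, (R t k s : ℝ) / 2 ^ k := by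
        refine Finset.sum_le_sum_of_subset_of_nonneg ?_ fun s _ _ => by positivity
        intro s hs
        rw [mem_Sk] at *
        omega
      linarith
    show (Nat.rfind fun k => Part.some (P t k)).Dom
    obtain ⟨n, hn, _⟩ := Nat.rfind_min' (p := P t) hPk
    exact Part.dom_iff_mem.2 ⟨n, hn⟩
  · intro s hs B hB hB'
    obtain ⟨k, hk, rfl⟩ := (Part.mem_map_iff _).1 hs
    have hPk : P t k = true := (Part.mem_some_iff.1 (Nat.rfind_spec hk)).symm
    rw [hPiff, hTr] at hPk
    have hnot : List.replicate k true ∉ Sk k := by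
      rw [mem_Sk, not_lt]
      simpa using length_le_encode (List.replicate k true)
    have e1 : ∑ s ∈ insert (List.replicate k true) (Sk k), m s ^ q ≤ S :=
      hmqs.sum_le_tsum _ fun s _ => hmq0 s
    rw [Finset.sum_insert hnot] at e1
    have e2 : ∑ s ∈ Sk k, (R t k s : ℝ) / 2 ^ k ≤ ∑ s ∈ Sk k, (m s ^ q + B * m s) := by
      refine Finset.sum_le_sum fun s _ => (hRle k s).trans ?_
      have a1 := hB' (f k s) (hf0 k s) ((hfle k s).trans (hm01 s).2)
      have a2 : (f k s : ℝ) ^ q ≤ m s ^ q := Real.rpow_le_rpow (hf0 k s) (hfle k s) (by linarith)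
      have a3 := mul_le_mul_of_nonneg_left (hfle k s) hB
      linarith
    rw [Finset.sum_add_distrib, ← Finset.mul_sum] at e2
    have e3 := mul_le_mul_of_nonneg_left (hmsum (Sk k)) hB
    have e4 := hgS k
    linarith

theorem length_binPrefix (q : ℝ) (n : ℕ) : (binPrefix q n).length = n := by
  simp [binPrefix]

theorem bval_append (t : Str) (b : Bool) : bval (t ++ [b]) = 2 * bval t + b.toNat := by
  simp [bval, List.foldl_append]

theorem binPrefix_succ (q : ℝ) (n : ℕ) : binPrefix q (n + 1) =
    binPrefix q n ++ [decide (⌊Int.fract q * 2 ^ (n + 1)⌋ % 2 = 1)] := by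
  simp [binPrefix, List.range_succ]

theorem bval_binPrefix (q : ℝ) (n : ℕ) : (bval (binPrefix q n) : ℤ) = ⌊Int.fract q * 2 ^ n⌋ := by
  induction n with
  | zero =>
    have : ⌊Int.fract q⌋ = 0 := Int.floor_fract q
    simp [binPrefix, bval]
  | succ n ih =>
    rw [binPrefix_succ, bval_append]
    push_cast
    rw [ih]
    have h2 : ⌊Int.fract q * 2 ^ n⌋ = ⌊Int.fract q * 2 ^ (n + 1)⌋ / 2 := by
      have := Int.floor_div_natCast (Int.fract q * 2 ^ (n + 1)) 2
      rw [← show (((2 : ℕ) : ℤ)) = 2 from rfl, ← this]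
      congr 1
      push_cast
      rw [pow_succ]; ring
    by_cases h : ⌊Int.fract q * 2 ^ (n + 1)⌋ % 2 = 1
    · simp only [h, decide_true, Bool.toNat_true]
      omega
    · simp only [h, decide_false, Bool.toNat_false]
      omega

theorem exists_program (U : OptimalComputer) (t : Str) :
    ∃ p : Str, p.length = Kc U t ∧ t ∈ U.f p := by
  have : Partrec (fun p : Str => (bif decide (p = []) then Part.some t else Part.none : Part Str)) :=
    Partrec.cond (Primrec.eq.decide.to_comp.comp Computable.id (Computable.const []))
      (Computable.const t).partrec Partrec.none
  let C : Computer := ⟨_, this, by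
    intro p q hp hq _
    by_cases h1 : p = []
    · by_cases h2 : q = []
      · rw [h1, h2]
      · simp [h2] at hq
    · simp [h1] at hp⟩
  obtain ⟨sim, hs⟩ := U.optimal C
  obtain ⟨p', hp', _⟩ := hs [] t (by simp [C])
  exact Nat.sInf_mem (s := {n | ∃ p : Str, p.length = n ∧ t ∈ U.f p}) ⟨_, p', rfl, hp'⟩

theorem rpow_bound (q r e x : ℝ) (he : 0 < e) (hr : 1 + e ≤ r) (hrq : r ≤ q) (hx0 : 0 ≤ x)
    (hx1 : x ≤ 1) : x ^ r - x ^ q ≤ (q - r) / e * x := by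
  rcases hx0.eq_or_lt with h | hx
  · subst h
    rw [Real.zero_rpow (by linarith), Real.zero_rpow (by linarith)]; simp
  · have h1 : x ^ q = x ^ r * x ^ (q - r) := by
      rw [← Real.rpow_add hx]; congr 1; ring
    have h2 : 1 - x ^ (q - r) ≤ (q - r) * (-Real.log x) := by
      rw [Real.rpow_def_of_pos hx]
      have := Real.add_one_le_exp (Real.log x * (q - r))
      linarith
    have h3 : x ^ r ≤ x * x ^ e := by
      have : x * x ^ e = x ^ (1 + e) := by rw [Real.rpow_add hx, Real.rpow_one]
      rw [this]
      exact Real.rpow_le_rpow_of_exponent_ge hx hx1 hr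
    have h4 : -Real.log x ≤ (x ^ e)⁻¹ / e := by
      have := Real.log_le_rpow_div (x := x⁻¹) (by positivity) he
      rwa [Real.log_inv, Real.inv_rpow hx0] at this
    have hxe : 0 < x ^ e := Real.rpow_pos_of_pos hx e
    have hl : 0 ≤ -Real.log x := by
      have := Real.log_nonpos hx0 hx1; linarith
    have hqr : 0 ≤ q - r := by linarith
    calc x ^ r - x ^ q = x ^ r * (1 - x ^ (q - r)) := by rw [h1]; ring
      _ ≤ x ^ r * ((q - r) * (-Real.log x)) := mul_le_mul_of_nonneg_left h2 (Real.rpow_nonneg hx0 r)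
      _ ≤ (x * x ^ e) * ((q - r) * (-Real.log x)) := mul_le_mul_of_nonneg_right h3 (mul_nonneg hqr hl)
      _ ≤ (x * x ^ e) * ((q - r) * ((x ^ e)⁻¹ / e)) := by gcongr
      _ = (q - r) / e * x := by field_simp

theorem case_gt (U : OptimalComputer) (m : Str → ℝ) (hm : UniversalProb m)
    (q : ℝ) (hq : 1 < q) (hrc : RightComputableReal (∑' s, m s ^ q)) :
    ∃ c : ℕ, ∀ n : ℕ, (n : ℝ) / q - c ≤ Kc U (binPrefix q n) := by
  obtain ⟨h, hh, hspec⟩ := main_search m hm.1 q hq.le hrc ⌊q⌋.toNat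
  let C : Computer := ⟨fun p => (U.f p).bind h, U.partrec.bind (hh.comp Computable.snd).to₂, by
    intro p p' hp hp' hpp
    exact U.prefixFree p p' hp.1 hp'.1 hpp⟩
  obtain ⟨c, hc0, hc⟩ := univ_dom m hm C
  set e := (q - 1) / 2 with he
  have he0 : 0 < e := by rw [he]; linarith
  obtain ⟨n0, hn0⟩ := exists_pow_lt_of_lt_one he0 (show (2 : ℝ)⁻¹ < 1 by norm_num)
  set A : ℝ := 1 + 1 / e with hA
  have hA0 : 0 < A := by positivity
  obtain ⟨c1, hc1⟩ := exists_nat_ge (Real.logb 2 A / q - Real.logb 2 c)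
  refine ⟨max n0 c1, fun n => ?_⟩
  have hq0 : 0 < q := by linarith
  by_cases hn : n < n0
  · have h1 : (n : ℝ) / q ≤ n := div_le_self (Nat.cast_nonneg n) hq.le
    have h2 : (n : ℝ) ≤ (max n0 c1 : ℕ) := by exact_mod_cast hn.le.trans (le_max_left _ _)
    have h3 : (0 : ℝ) ≤ Kc U (binPrefix q n) := Nat.cast_nonneg _
    linarith
  · push Not at hn
    obtain ⟨p, hpl, hpU⟩ := exists_program U (binPrefix q n)
    have hpow : (2 : ℝ)⁻¹ ^ n ≤ (2 : ℝ)⁻¹ ^ n0 := pow_le_pow_of_le_one (by norm_num) (by norm_num) hn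
    have hfl : (1 : ℤ) ≤ ⌊q⌋ := Int.le_floor.2 (by exact_mod_cast hq.le)
    have hQ : ((⌊q⌋.toNat : ℕ) : ℝ) = (⌊q⌋ : ℝ) := by
      exact_mod_cast (Int.toNat_of_nonneg (show 0 ≤ ⌊q⌋ by omega))
    have hbv : ((bval (binPrefix q n) : ℕ) : ℝ) = (⌊Int.fract q * 2 ^ n⌋ : ℝ) := by
      exact_mod_cast congrArg (fun z : ℤ => (z : ℝ)) (bval_binPrefix q n)
    obtain ⟨r, hr⟩ : ∃ r : ℝ, r = (⌊q⌋.toNat : ℕ) + (bval (binPrefix q n) : ℝ) / 2 ^ (binPrefix q n).length := ⟨_, rfl⟩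
    have hr' := hr
    rw [hQ, hbv, length_binPrefix] at hr'
    have h2n : (0 : ℝ) < 2 ^ n := by positivity
    have hfr := Int.floor_add_fract q
    have hrq : r ≤ q := by
      have : (⌊Int.fract q * 2 ^ n⌋ : ℝ) / 2 ^ n ≤ Int.fract q := by
        rw [div_le_iff₀ h2n]; exact Int.floor_le _
      linarith
    have hqr : q - r ≤ (2 : ℝ)⁻¹ ^ n := by
      have : Int.fract q - (2 : ℝ)⁻¹ ^ n ≤ (⌊Int.fract q * 2 ^ n⌋ : ℝ) / 2 ^ n := by
        rw [le_div_iff₀ h2n, sub_mul, ← mul_pow]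
        have := Int.lt_floor_add_one (Int.fract q * 2 ^ n)
        norm_num
        linarith
      linarith
    have hre : 1 + e ≤ r := by linarith
    obtain ⟨hd, hs⟩ := hspec _ r hr (by linarith) hrq
    obtain ⟨s, hs'⟩ := Part.dom_iff_mem.1 hd
    have hB := hs s hs' ((2 : ℝ)⁻¹ ^ n / e) (by positivity) (fun x hx0 hx1 =>
      (rpow_bound q r e x he0 hre hrq hx0 hx1).trans (by gcongr))
    rw [length_binPrefix] at hB
    have hB2 : m s ^ q ≤ A * (2 : ℝ)⁻¹ ^ n := by rw [hA]; refine hB.trans (le_of_eq ?_); ring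
    have hlow := hc p s (Part.mem_bind hpU hs')
    rw [hpl] at hlow
    set K := Kc U (binPrefix q n)
    have h5 : (c * (2 : ℝ)⁻¹ ^ K) ^ q ≤ A * (2 : ℝ)⁻¹ ^ n :=
      (Real.rpow_le_rpow (by positivity) hlow hq0.le).trans hB2
    have h6 := Real.logb_le_logb_of_le (b := 2) (by norm_num) (by positivity) h5
    have hl : ∀ k : ℕ, Real.logb 2 ((2 : ℝ)⁻¹ ^ k) = -k := by
      intro k
      rw [inv_pow, Real.logb_inv, Real.logb_pow, Real.logb_self_eq_one (by norm_num)]; simp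
    rw [Real.logb_rpow_eq_mul_logb_of_pos (by positivity), Real.logb_mul (by positivity) (by positivity),
      Real.logb_mul (by positivity) (by positivity), hl, hl] at h6
    have h7 : (n : ℝ) / q ≤ Real.logb 2 A / q - Real.logb 2 c + K := by
      have : Real.logb 2 A / q - Real.logb 2 c + K = (Real.logb 2 A - q * Real.logb 2 c + q * K) / q := by
        field_simp
      rw [this]
      gcongr
      linarith
    have h8 : (c1 : ℝ) ≤ (max n0 c1 : ℕ) := by exact_mod_cast le_max_right _ _
    linarith

/-- The self-delimiting code `0^n 1` of `n`. -/
def ucode (n : ℕ) : Str := List.replicate n false ++ [true]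

theorem primrec_replicate_false : Primrec (fun k : ℕ => List.replicate k false) :=
  (Primrec.list_map Primrec.list_range (Primrec.const false).to₂).of_eq fun k => by simp

theorem primrec_ucode : Primrec ucode :=
  Primrec.list_append.comp primrec_replicate_false (Primrec.const [true])

theorem ucode_length (n : ℕ) : (ucode n).length = n + 1 := by simp [ucode]

theorem ucode_prefix : ∀ a b : ℕ, ucode a <+: ucode b → a = b
  | 0, 0, _ => rfl
  | 0, b + 1, h => by simp [ucode, List.replicate_succ] at h
  | a + 1, 0, h => by have := h.length_le; simp [ucode] at this
  | a + 1, b + 1, h => by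
    have h' : ucode a <+: ucode b := by
      simpa [ucode, List.replicate_succ, List.cons_prefix_cons] using h
    rw [ucode_prefix a b h']

theorem bval_replicate (n : ℕ) : bval (List.replicate n false) = 0 := by
  induction n with
  | zero => rfl
  | succ n ih => rw [List.replicate_succ', bval_append, ih]; rfl

theorem case_one (m : Str → ℝ) (hm : UniversalProb m)
    (hrc : RightComputableReal (∑' s, m s ^ (1 : ℝ))) : False := by
  obtain ⟨h, hh, hspec⟩ := main_search m hm.1 1 le_rfl hrc 1
  let F : Str →. ℕ := fun p => Nat.rfind fun n => Part.some (decide (p = ucode n))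
  have hF : Partrec F := by
    refine Partrec.rfind (p := fun (p : Str) (n : ℕ) => Part.some (decide (p = ucode n))) ?_
    have : Computable₂ (fun (p : Str) (n : ℕ) => decide (p = ucode n)) :=
      Primrec.eq.decide.to_comp.comp Computable.fst (primrec_ucode.to_comp.comp Computable.snd)
    exact this.partrec₂
  have hFspec : ∀ p n, n ∈ F p → p = ucode n := by
    intro p n hn
    have := Part.mem_some_iff.1 (Nat.rfind_spec hn)
    simpa using this.symm
  have hFmem : ∀ n, n ∈ F (ucode n) := by
    intro n
    obtain ⟨k, hk, _⟩ := Nat.rfind_min' (p := fun k => decide (ucode n = ucode k)) (m := n) (by simp)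
    have h1 := hFspec _ _ hk
    have : n = k := ucode_prefix n k (by rw [← h1])
    subst this
    exact hk
  let C : Computer := ⟨fun p => (F p).bind fun n => h (List.replicate (2 * n) false),
    hF.bind (hh.comp (primrec_replicate_false.to_comp.comp
      (Primrec.nat_mul.to_comp.comp (Computable.const 2) Computable.snd))).to₂, by
    intro p p' hp hp' hpp
    obtain ⟨a, ha⟩ := Part.dom_iff_mem.1 hp.1
    obtain ⟨b, hb⟩ := Part.dom_iff_mem.1 hp'.1
    rw [hFspec _ _ ha, hFspec _ _ hb] at hpp ⊢
    rw [ucode_prefix _ _ hpp]⟩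
  obtain ⟨c, hc0, hc⟩ := univ_dom m hm C
  have key : ∀ n : ℕ, c ≤ 2 * (2 : ℝ)⁻¹ ^ n := by
    intro n
    obtain ⟨hd, hs⟩ := hspec (List.replicate (2 * n) false) 1 (by rw [bval_replicate]; simp) le_rfl le_rfl
    obtain ⟨s, hs'⟩ := Part.dom_iff_mem.1 hd
    have h1 := hs s hs' 0 le_rfl (by intro x _ _; simp)
    have h2 := hc (ucode n) s (Part.mem_bind (hFmem n) hs')
    rw [Real.rpow_one, List.length_replicate, add_zero, two_mul, pow_add] at h1
    rw [ucode_length, pow_succ] at h2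
    have hp : (0 : ℝ) < (2 : ℝ)⁻¹ ^ n := by positivity
    have h3 := h2.trans h1
    have h4 : c * (2 : ℝ)⁻¹ ≤ (2 : ℝ)⁻¹ ^ n := by
      refine le_of_mul_le_mul_right ?_ hp
      linarith
    linarith
  obtain ⟨n, hn⟩ := exists_pow_lt_of_lt_one (show 0 < c / 2 by linarith) (show (2 : ℝ)⁻¹ < 1 by norm_num)
  have := key n
  linarith

/-- If `q ≥ 1` and the power sum `∑ s, m s ^ q` of a universal probability `m`
is right-computable, then `q` is weakly Chaitin `1/q`-random. -/
theorem q_random_of_power_sum_right_computable (U : OptimalComputer)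
    (m : Str → ℝ) (hm : UniversalProb m)
    (q : ℝ) (hq : 1 ≤ q) (hrc : RightComputableReal (∑' s, m s ^ q)) :
    ∃ c : ℕ, ∀ n : ℕ, (n : ℝ) / q - c ≤ Kc U (binPrefix q n) := by
  rcases hq.eq_or_lt with h | h
  · subst h
    exact (case_one m hm hrc).elim
  · exact case_gt U m hm q h hrc

end Paper
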